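/- arXiv:1812.10880 — 2 statements merged into one kernel-verified Lean document; each statement's English description precedes it below -/
import Mathlib

section
/- Let G be a finite 2-transitive permutation group on a finite set Ω and let N be a nontrivial normal subgroup of G. Then N is either regular on Ω or (3/2)-transitive on Ω, i.e., N is transitive and for each α ∈ Ω all orbits of the point stabilizer N_α on Ω ∖ {α} have the same length, which is greater than 1. -/
open SimpleGraph

namespace EdgePrimitivePaper

/-! ### Group-theoretic preliminaries -/

/-- `N` is a minimal normal subgroup of `G`. -/
def IsMinimalNormal {G : Type*} [Group G] (N : Subgroup G) : Prop :=
  N.Normal ∧ N ≠ ⊥ ∧ ∀ M : Subgroup G, M.Normal → M ≠ ⊥ → M ≤ N → M = N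

/-- A finite group is almost simple if it has a unique minimal normal subgroup,
which is a nonabelian simple group. -/
def IsAlmostSimpleGroup (G : Type*) [Group G] : Prop :=
  ∃ N : Subgroup G, IsMinimalNormal N ∧ (∀ M : Subgroup G, IsMinimalNormal M → M = N) ∧
    IsSimpleGroup N ∧ ¬ (∀ x y : N, x * y = y * x)

/-- The socle of a group: the subgroup generated by all minimal normal subgroups. -/
def socle (G : Type*) [Group G] : Subgroup G :=
  ⨆ (N : Subgroup G) (_ : IsMinimalNormal N), N

/-- `P` is a Sylow `p`-subgroup of the subgroup `H`, i.e. a maximal `p`-subgroup of `H`. -/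
def IsSylowIn {G : Type*} [Group G] (p : ℕ) (P H : Subgroup G) : Prop :=
  P ≤ H ∧ IsPGroup p P ∧ ∀ Q : Subgroup G, Q ≤ H → IsPGroup p Q → P ≤ Q → Q = P

/-- The `p`-core `O_p(G)`: the largest normal `p`-subgroup of `G`
(here defined as the join of all normal `p`-subgroups). -/
def pCore (p : ℕ) (G : Type*) [Group G] : Subgroup G :=
  ⨆ (N : Subgroup G) (_ : N.Normal ∧ IsPGroup p N), N

/-! ### Graphs, automorphisms, stabilizers -/

variable {V : Type*} (Γ : SimpleGraph V)

variable {G : Type*} [Group G] (φ : G →* (Γ ≃g Γ))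

/-- The stabilizer in `G` (acting on `Γ` through `φ`) of a vertex `v`. -/
def vStab (v : V) : Subgroup G where
  carrier := {g | φ g v = v}
  one_mem' := by simp
  mul_mem' := by
    intro a b ha hb
    simp only [Set.mem_setOf_eq, map_mul, RelIso.mul_apply] at *
    rw [hb, ha]
  inv_mem' := by
    intro a ha
    simp only [Set.mem_setOf_eq, map_inv] at *
    conv_lhs => rw [← ha]
    exact RelIso.inv_apply_self _ _

/-- The setwise stabilizer in `G` of an unordered pair `e` of vertices. -/
def eStab (e : Sym2 V) : Subgroup G where
  carrier := {g | Sym2.map (φ g) e = e}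
  one_mem' := by simp
  mul_mem' := by
    intro a b ha hb
    simp only [Set.mem_setOf_eq, map_mul] at *
    rw [RelIso.coe_mul, ← Sym2.map_map, hb, ha]
  inv_mem' := by
    intro a ha
    simp only [Set.mem_setOf_eq, map_inv] at *
    conv_lhs => rw [← ha]
    rw [Sym2.map_map]
    have hcomp : ⇑(φ a)⁻¹ ∘ ⇑(φ a) = id := funext fun x => RelIso.inv_apply_self _ _
    rw [hcomp, Sym2.map_id, id_eq]

/-- The arc stabilizer `G_{uv}`. -/
def aStab (u v : V) : Subgroup G := vStab Γ φ u ⊓ vStab Γ φ v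

/-- `G` is transitive on the vertices of `Γ`. -/
def IsVertexTransitive : Prop := ∀ u v : V, ∃ g : G, φ g u = v

/-- `G` is transitive on the edge set of `Γ` (which is required to be nonempty). -/
def IsEdgeTransitive : Prop :=
  Γ.edgeSet.Nonempty ∧ ∀ e₁ ∈ Γ.edgeSet, ∀ e₂ ∈ Γ.edgeSet, ∃ g : G, Sym2.map (φ g) e₁ = e₂

/-- `Γ` is `G`-edge-primitive: `G` is transitive on edges and
every edge stabilizer is a maximal subgroup of `G`. -/
def IsEdgePrimitive : Prop :=
  IsEdgeTransitive Γ φ ∧ ∀ e ∈ Γ.edgeSet, IsCoatom (eStab Γ φ e)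

/-- An `s`-arc of `Γ`: a sequence of `s+1` vertices, consecutive ones adjacent,
with no immediate returns. -/
def IsSArc (s : ℕ) (p : Fin (s + 1) → V) : Prop :=
  (∀ (i : ℕ) (h : i + 1 ≤ s), Γ.Adj (p ⟨i, by omega⟩) (p ⟨i + 1, by omega⟩)) ∧
  (∀ (i : ℕ) (h : i + 2 ≤ s), p ⟨i, by omega⟩ ≠ p ⟨i + 2, by omega⟩)

/-- `Γ` is `(G,s)`-arc-transitive: `Γ` has an `s`-arc and `G` is transitive on `s`-arcs. -/
def IsSArcTransitive (s : ℕ) : Prop :=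
  (∃ p, IsSArc Γ s p) ∧
    ∀ p q, IsSArc Γ s p → IsSArc Γ s q → ∃ g : G, ∀ i, φ g (p i) = q i

/-- `N` (a subgroup of `G`) is transitive on the arcs of `Γ`. -/
def SubgroupArcTransitive (N : Subgroup G) : Prop :=
  ∀ a b c d : V, Γ.Adj a b → Γ.Adj c d → ∃ g ∈ N, φ g a = c ∧ φ g b = d

/-- `N` (a subgroup of `G`) is transitive on the vertices of `Γ`. -/
def SubgroupVertexTransitive (N : Subgroup G) : Prop :=
  ∀ u v : V, ∃ g ∈ N, φ g u = v

/-- The permutation of the neighbourhood `Γ(v)` induced by an element of `G_v`. -/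
def localPerm (v : V) (g : ↥(vStab Γ φ v)) : Equiv.Perm (Γ.neighborSet v) where
  toFun x := ⟨φ (g : G) x, by
    have hx : Γ.Adj v x := x.2
    have hgv : φ (g : G) v = v := g.2
    have := (φ (g : G)).map_rel_iff.mpr hx
    rwa [hgv] at this⟩
  invFun x := ⟨φ (g : G)⁻¹ x, by
    have hx : Γ.Adj v x := x.2
    have hgv : φ (g : G) v = v := g.2
    have hgv' : φ (g : G)⁻¹ v = v := by
      rw [map_inv]
      have h2 := RelIso.inv_apply_self (φ (g : G)) v
      rwa [hgv] at h2
    have := (φ (g : G)⁻¹).map_rel_iff.mpr hx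
    rwa [hgv'] at this⟩
  left_inv x := by
    ext
    simp only [map_inv]
    exact RelIso.inv_apply_self _ _
  right_inv x := by
    ext
    simp only [map_inv]
    exact RelIso.apply_inv_self _ _

/-- The homomorphism from `G_v` to the permutation group of the neighbourhood `Γ(v)`,
i.e. the local action of `G_v` on `Γ(v)`. -/
def localHom (v : V) : ↥(vStab Γ φ v) →* Equiv.Perm (Γ.neighborSet v) where
  toFun := localPerm Γ φ v
  map_one' := by
    ext x
    simp [localPerm]
  map_mul' g h := by
    ext x
    simp [localPerm, RelIso.mul_apply]

/-- The permutation group `G_v^{Γ(v)}` induced by `G_v` on `Γ(v)`. -/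
def localGroup (v : V) : Subgroup (Equiv.Perm (Γ.neighborSet v)) :=
  (localHom Γ φ v).range

/-- The permutation group induced on `Γ(v)` by a subgroup `H ≤ G_v`. -/
def inducedLocal (H : Subgroup G) (v : V) : Subgroup (Equiv.Perm (Γ.neighborSet v)) :=
  Subgroup.map (localHom Γ φ v) (H.subgroupOf (vStab Γ φ v))

/-- The kernel `G_v^{[1]}` of the action of `G_v` on `Γ(v)`, as a subgroup of `G`. -/
def localKernel (v : V) : Subgroup G :=
  Subgroup.map (vStab Γ φ v).subtype (localHom Γ φ v).ker

/-- `Γ` is `G`-locally primitive: every `G_v^{Γ(v)}` is a primitive permutation group,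
i.e. transitive with maximal point stabilizers. -/
def IsLocallyPrimitive : Prop :=
  ∀ v : V, (∀ x y : Γ.neighborSet v, ∃ σ ∈ localGroup Γ φ v, σ x = y) ∧
    ∀ x : Γ.neighborSet v, IsCoatom (MulAction.stabilizer (localGroup Γ φ v) x)

end EdgePrimitivePaper

open EdgePrimitivePaper in
/-- **Lemma 2.1, second part.** In a finite 2-transitive permutation group
`G` on `Ω`, a nontrivial normal subgroup `N` is either regular or `3/2`-transitive
(transitive, and for each `α` all orbits of `N_α` on `Ω ∖ {α}` have equal length `> 1`). -/
theorem stmt_12 {G : Type*} [Group G] [Finite G] {Ω : Type*} [Finite Ω]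
    [MulAction G Ω] [FaithfulSMul G Ω]
    (htrans : MulAction.IsPretransitive G Ω)
    (h2trans : ∀ α β γ : Ω, β ≠ α → γ ≠ α → ∃ g ∈ MulAction.stabilizer G α, g • β = γ)
    (N : Subgroup G) (hN : N.Normal) (hNbot : N ≠ ⊥) :
    ((∀ β γ : Ω, ∃ n ∈ N, n • β = γ) ∧ ∀ β : Ω, N ⊓ MulAction.stabilizer G β = ⊥) ∨
      ((∀ β γ : Ω, ∃ n ∈ N, n • β = γ) ∧
        ∀ α : Ω, ∃ ℓ : ℕ, 1 < ℓ ∧ ∀ β : Ω, β ≠ α →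
          (MulAction.orbit ↥(N ⊓ MulAction.stabilizer G α) β).ncard = ℓ) := by
  have hT : ∀ β γ : Ω, ∃ n ∈ N, n • β = γ := by
    intro β γ
    by_cases hβγ : γ = β
    · exact ⟨1, N.one_mem, by simp [hβγ]⟩
    obtain ⟨⟨n, hn⟩, hn1⟩ := Subgroup.ne_bot_iff_exists_ne_one.1 hNbot
    replace hn1 : n ≠ 1 := fun h => hn1 (Subtype.ext h)
    obtain ⟨ω, hω⟩ : ∃ ω : Ω, n • ω ≠ ω := by
      by_contra! hc
      exact hn1 (FaithfulSMul.eq_of_smul_eq_smul (α := Ω) fun a => by rw [hc a, one_smul])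
    obtain ⟨g, hg⟩ := htrans.exists_smul_eq ω β
    have h1 : g • n • ω ≠ β := by
      intro h
      rw [← hg] at h
      exact hω (smul_left_cancel g h)
    obtain ⟨h, hh, hh2⟩ := h2trans β _ γ h1 hβγ
    refine ⟨(h * g) * n * (h * g)⁻¹, hN.conj_mem n hn _, ?_⟩
    have h3 : (h * g)⁻¹ • β = ω := by
      rw [inv_smul_eq_iff, mul_smul, hg]
      exact hh.symm
    rw [mul_smul, h3, mul_smul, mul_smul, hh2]
  by_cases hreg : ∀ β : Ω, N ⊓ MulAction.stabilizer G β = ⊥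
  · exact Or.inl ⟨hT, hreg⟩
  refine Or.inr ⟨hT, fun α => ?_⟩
  push Not at hreg
  obtain ⟨β₀, hβ₀⟩ := hreg
  obtain ⟨⟨n, hn, hns⟩, hn1⟩ := Subgroup.ne_bot_iff_exists_ne_one.1 hβ₀
  replace hn1 : n ≠ 1 := fun h => hn1 (Subtype.ext h)
  replace hns : n • β₀ = β₀ := hns
  obtain ⟨ω, hω⟩ : ∃ ω : Ω, n • ω ≠ ω := by
    by_contra! hc
    exact hn1 (FaithfulSMul.eq_of_smul_eq_smul (α := Ω) fun a => by rw [hc a, one_smul])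
  obtain ⟨g, hg⟩ := htrans.exists_smul_eq β₀ α
  have hωβ : ω ≠ β₀ := fun h => hω (h ▸ hns)
  have hga : g • ω ≠ α := fun h => hωβ (smul_left_cancel g (h.trans hg.symm))
  have hm : g * n * g⁻¹ ∈ N ⊓ MulAction.stabilizer G α := by
    refine ⟨hN.conj_mem n hn g, ?_⟩
    change (g * n * g⁻¹) • α = α
    rw [← hg, mul_smul, inv_smul_smul, mul_smul, hns]
  have hmul : ∀ k ∈ MulAction.stabilizer G α, ∀ x ∈ N ⊓ MulAction.stabilizer G α,
      k * x * k⁻¹ ∈ N ⊓ MulAction.stabilizer G α := fun k hk x hx =>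
    ⟨hN.conj_mem x hx.1 k, (MulAction.stabilizer G α).mul_mem
      ((MulAction.stabilizer G α).mul_mem hk hx.2) ((MulAction.stabilizer G α).inv_mem hk)⟩
  refine ⟨(MulAction.orbit ↥(N ⊓ MulAction.stabilizer G α) (g • ω)).ncard, ?_, ?_⟩
  · rw [Set.one_lt_ncard (Set.toFinite _)]
    refine ⟨g • ω, MulAction.mem_orbit_self _, g • n • ω, ⟨⟨_, hm⟩, ?_⟩, ?_⟩
    · change (g * n * g⁻¹) • g • ω = g • n • ω
      rw [mul_smul, inv_smul_smul, mul_smul]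
    · exact fun h => hω (smul_left_cancel g h).symm
  · intro β hβ
    obtain ⟨k, hk, hkβ⟩ := h2trans α _ β hga hβ
    rw [← Set.ncard_image_of_injective
      (MulAction.orbit ↥(N ⊓ MulAction.stabilizer G α) (g • ω)) (MulAction.injective k)]
    congr 1
    ext y
    constructor
    · rintro ⟨⟨x, hx⟩, rfl⟩
      refine ⟨(k⁻¹ * x * k) • g • ω, ⟨⟨k⁻¹ * x * k, ?_⟩, rfl⟩, ?_⟩
      · simpa using hmul k⁻¹ (inv_mem hk) x hx
      · change k • (k⁻¹ * x * k) • g • ω = x • β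
        rw [← hkβ, mul_smul, mul_smul, smul_inv_smul]
    · rintro ⟨_, ⟨⟨x, hx⟩, rfl⟩, rfl⟩
      refine ⟨⟨_, hmul k hk x hx⟩, ?_⟩
      change (k * x * k⁻¹) • β = k • x • g • ω
      rw [← hkβ, mul_smul, inv_smul_smul, mul_smul]
end

section
/- Let Γ = (V,E) be a finite connected d-regular graph for some d ≥ 3, let G ≤ Aut Γ act transitively on V, assume Γ is G-locally primitive, and let {u,v} ∈ E. Then: (i) G_{uv}^{[1]} is a p-group for some prime p; (ii) the permutation group induced by G_v^{[1]} on Γ(u) is isomorphic to a normal subgroup of the point stabilizer (G_v^{Γ(v)})_u of the primitive group G_v^{Γ(v)}; (iii) G_v is soluble if and only if G_v^{Γ(v)} is soluble. -/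
open SimpleGraph

namespace TW
open scoped commutatorElement
variable {G : Type*} [Group G]

/-- `A` is a normal subgroup of `B` -/
def NS (A B : Subgroup G) : Prop := A ≤ B ∧ ∀ b ∈ B, ∀ a ∈ A, b * a * b⁻¹ ∈ A

/-- `A` is subnormal in `B` -/
def SN (A B : Subgroup G) : Prop := Relation.ReflTransGen NS A B

theorem NS.sn {A B : Subgroup G} (h : NS A B) : SN A B := Relation.ReflTransGen.single h

theorem SN.refl (A : Subgroup G) : SN A A := Relation.ReflTransGen.refl

theorem SN.trans {A B C : Subgroup G} (h : SN A B) (h' : SN B C) : SN A C :=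
  Relation.ReflTransGen.trans h h'

theorem SN.le {A B : Subgroup G} (h : SN A B) : A ≤ B := by
  induction h with
  | refl => exact le_rfl
  | tail _ h ih => exact ih.trans h.1

theorem NS.inf {A B : Subgroup G} (h : NS A B) (L : Subgroup G) : NS (A ⊓ L) (B ⊓ L) := by
  refine ⟨inf_le_inf_right _ h.1, ?_⟩
  rintro b ⟨hb, hb'⟩ a ⟨ha, ha'⟩
  exact ⟨h.2 b hb a ha, L.mul_mem (L.mul_mem hb' ha') (L.inv_mem hb')⟩

theorem SN.inf {A B : Subgroup G} (h : SN A B) (L : Subgroup G) : SN (A ⊓ L) (B ⊓ L) :=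
  Relation.ReflTransGen.lift (fun A => A ⊓ L) (fun _ _ h => NS.inf h L) _ _ h

theorem SN.of_le {A B L : Subgroup G} (h : SN A B) (hA : A ≤ L) (hL : L ≤ B) : SN A L := by
  have := h.inf L
  rwa [inf_eq_left.2 hA, inf_eq_right.2 hL] at this

theorem SN.top {A H : Subgroup G} (h : SN A H) :
    A = H ∨ ∃ H1, SN A H1 ∧ NS H1 H ∧ H1 < H := by
  induction h with
  | refl => exact Or.inl rfl
  | @tail B C hAB hBC ih =>
    by_cases e : B = C
    · subst e; exact ih
    · exact Or.inr ⟨B, hAB, hBC, lt_of_le_of_ne hBC.1 e⟩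

/-- the conjugate of a subgroup -/
def cj (g : G) (H : Subgroup G) : Subgroup G := H.map (MulAut.conj g).toMonoidHom

theorem mem_cj {g x : G} {H : Subgroup G} : x ∈ cj g H ↔ g⁻¹ * x * g ∈ H := by
  constructor
  · rintro ⟨y, hy, rfl⟩
    have : g⁻¹ * (g * y * g⁻¹) * g = y := by group
    simpa [this] using hy
  · intro h
    refine ⟨_, h, ?_⟩
    simp [mul_assoc]

theorem conj_mem_cj {g x : G} {H : Subgroup G} : g * x * g⁻¹ ∈ cj g H ↔ x ∈ H := by
  rw [mem_cj]
  have : g⁻¹ * (g * x * g⁻¹) * g = x := by group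
  rw [this]

theorem cj_cj (g h : G) (H : Subgroup G) : cj g (cj h H) = cj (g * h) H := by
  ext x; simp [mem_cj, mul_assoc]

theorem cj_one (H : Subgroup G) : cj 1 H = H := by ext x; simp [mem_cj]

theorem cj_mono {g : G} {H K : Subgroup G} (h : H ≤ K) : cj g H ≤ cj g K :=
  Subgroup.map_mono h

theorem cj_inf (g : G) (H K : Subgroup G) : cj g (H ⊓ K) = cj g H ⊓ cj g K := by
  ext x; simp [mem_cj, Subgroup.mem_inf]

theorem cj_bot (g : G) : cj g (⊥ : Subgroup G) = ⊥ := Subgroup.map_bot _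

theorem cj_eq_bot {g : G} {H : Subgroup G} (h : cj g H = ⊥) : H = ⊥ := by
  rw [← cj_one H, ← inv_mul_cancel g, ← cj_cj, h, cj_bot]

theorem NS.conj {A B : Subgroup G} (h : NS A B) (g : G) : NS (cj g A) (cj g B) := by
  refine ⟨cj_mono h.1, ?_⟩
  intro b hb a ha
  rw [mem_cj] at *
  have := h.2 _ hb _ ha
  convert this using 1; group

theorem SN.conj {A B : Subgroup G} (h : SN A B) (g : G) : SN (cj g A) (cj g B) :=
  Relation.ReflTransGen.lift (fun A => cj g A) (fun _ _ h => NS.conj h g) _ _ h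

theorem isPGroup_cj {p : ℕ} {H : Subgroup G} (h : IsPGroup p H) (g : G) : IsPGroup p (cj g H) :=
  h.map _

theorem isPGroup_iff {p : ℕ} {H : Subgroup G} :
    IsPGroup p H ↔ ∀ x ∈ H, ∃ k : ℕ, x ^ p ^ k = 1 := by
  constructor
  · intro h x hx
    obtain ⟨k, hk⟩ := h ⟨x, hx⟩
    exact ⟨k, by simpa [Subtype.ext_iff] using hk⟩
  · rintro h ⟨x, hx⟩
    obtain ⟨k, hk⟩ := h x hx
    exact ⟨k, by simpa [Subtype.ext_iff] using hk⟩

/-- a subnormal `p`-subgroup lies in a normal `p`-subgroup -/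
theorem SN.exists_normal [Finite G] {p : ℕ} [Fact p.Prime] {B H : Subgroup G} (h : SN B H)
    (hB : IsPGroup p B) : ∃ Q, NS Q H ∧ IsPGroup p Q ∧ B ≤ Q := by
  induction h with
  | refl => exact ⟨B, ⟨le_rfl, fun b hb a ha => B.mul_mem (B.mul_mem hb ha) (B.inv_mem hb)⟩,
      hB, le_rfl⟩
  | @tail H1 H _ h ih =>
    have key : ∀ Q R : Subgroup G, NS Q H1 ∧ IsPGroup p Q → NS R H1 ∧ IsPGroup p R →
        NS (Q ⊔ R) H1 ∧ IsPGroup p ↥(Q ⊔ R) := by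
      rintro Q R ⟨hQ, hQp⟩ ⟨hR, hRp⟩
      refine ⟨⟨sup_le hQ.1 hR.1, ?_⟩, ?_⟩
      · intro b hb a ha
        have : Q ⊔ R ≤ cj b⁻¹ (Q ⊔ R) := by
          refine sup_le ?_ ?_
          · intro x hx
            rw [mem_cj]
            exact Subgroup.mem_sup_left (by simpa using hQ.2 b hb x hx)
          · intro x hx
            rw [mem_cj]
            exact Subgroup.mem_sup_right (by simpa using hR.2 b hb x hx)
        simpa [mem_cj] using this ha
      · refine IsPGroup.to_sup_of_normal_right' hQp hRp ?_
        intro x hx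
        rw [Subgroup.mem_normalizer_iff]
        intro y
        refine ⟨fun hy => hR.2 x (hQ.1 hx) y hy, fun hy => ?_⟩
        have := hR.2 _ (H1.inv_mem (hQ.1 hx)) _ hy
        convert this using 1; group
    obtain ⟨Q0, h0, h1, h2⟩ := ih
    obtain ⟨Q, hle, hQ⟩ := Set.Finite.exists_le_maximal
      (Set.toFinite {Q : Subgroup G | NS Q H1 ∧ IsPGroup p Q}) (a := Q0) ⟨h0, h1⟩
    refine ⟨Q, ⟨hQ.1.1.1.trans h.1, ?_⟩, hQ.1.2, h2.trans hle⟩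
    intro b hb a ha
    have e : cj b H1 = H1 := by
      ext x
      rw [mem_cj]
      refine ⟨fun hx => ?_, fun hx => ?_⟩
      · have := h.2 b hb _ hx
        convert this using 1; group
      · have := h.2 _ (H.inv_mem hb) _ hx
        simpa using this
    have h3 : NS (cj b Q) H1 := by
      have := hQ.1.1.conj b
      rwa [e] at this
    have h4 := hQ.2 (key _ _ hQ.1 ⟨h3, isPGroup_cj hQ.1.2 b⟩) le_sup_left
    exact h4 (Subgroup.mem_sup_right (conj_mem_cj.2 ha))

/-- subgroup generated by the `p'`-elements -/
def OP (p : ℕ) (A : Subgroup G) : Subgroup G :=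
  Subgroup.closure {a | a ∈ A ∧ (orderOf a).Coprime p}

theorem OP_le (p : ℕ) (A : Subgroup G) : OP p A ≤ A :=
  (Subgroup.closure_le _).2 fun _ h => h.1

theorem cj_OP_le (p : ℕ) (g : G) (A : Subgroup G) : cj g (OP p A) ≤ OP p (cj g A) := by
  unfold OP cj
  rw [MonoidHom.map_closure]
  apply Subgroup.closure_mono
  rintro _ ⟨a, ⟨ha, hb⟩, rfl⟩
  refine ⟨⟨a, ha, rfl⟩, ?_⟩
  rw [orderOf_injective (MulAut.conj g).toMonoidHom (MulAut.conj g).injective a]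
  exact hb

theorem OP_ne_bot [Finite G] {p : ℕ} (hp : p.Prime) {A : Subgroup G} (h : ¬ IsPGroup p A) :
    OP p A ≠ ⊥ := by
  intro e
  apply h
  rw [isPGroup_iff]
  intro x hx
  obtain ⟨k, m, hm, hk⟩ := Nat.exists_eq_pow_mul_and_not_dvd (orderOf_pos x).ne' p hp.ne_one
  refine ⟨k, ?_⟩
  have : x ^ p ^ k ∈ OP p A := by
    apply Subgroup.subset_closure
    refine ⟨A.pow_mem hx _, ?_⟩
    rw [orderOf_pow_of_dvd (pow_pos hp.pos _).ne' (hk ▸ Dvd.intro _ rfl), hk,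
      Nat.mul_div_cancel_left _ (pow_pos hp.pos _)]
    exact ((Nat.Prime.coprime_iff_not_dvd hp).2 hm).symm
  rw [e] at this
  simpa using this

theorem mul_pow_mod {A A1 : Subgroup G} (h : NS A A1) {a q : G} (ha : a ∈ A) (hq : q ∈ A1) (n : ℕ) :
    ∃ c ∈ A, (a * q) ^ n = c * q ^ n := by
  induction n with
  | zero => exact ⟨1, A.one_mem, by simp⟩
  | succ n ih =>
    obtain ⟨c, hc, e⟩ := ih
    refine ⟨c * (q ^ n * a * (q ^ n)⁻¹), A.mul_mem hc (h.2 _ (A1.pow_mem hq _) _ ha), ?_⟩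
    rw [pow_succ, e, pow_succ]; group

theorem SN.pprime {p : ℕ} {A H Q : Subgroup G} (h : SN A H) (hQ : IsPGroup p Q) {t a q : G}
    (ht : (orderOf t).Coprime p) (htH : t ∈ H) (ha : a ∈ A) (hq : q ∈ Q) (e : t = a * q) :
    t ∈ A := by
  induction h using Relation.ReflTransGen.head_induction_on with
  | refl => exact htH
  | @head A A1 hA _ ih =>
    have ht1 := ih (hA.1 ha)
    have hq1 : q ∈ A1 := by
      have : q = a⁻¹ * t := by rw [e]; group
      rw [this]
      exact A1.mul_mem (A1.inv_mem (hA.1 ha)) ht1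
    obtain ⟨k, hk⟩ := isPGroup_iff.1 hQ q hq
    obtain ⟨c, hc, hc'⟩ := mul_pow_mod hA ha hq1 (p ^ k)
    rw [hk, mul_one, ← e] at hc'
    have h2 : t ∈ Subgroup.zpowers (t ^ p ^ k) := by
      obtain ⟨m, hm⟩ := exists_pow_eq_self_of_coprime (x := t) (n := p ^ k) (ht.symm.pow_left k)
      exact ⟨m, by simpa using hm⟩
    exact (Subgroup.zpowers_le.2 (hc' ▸ hc)) h2

theorem SN.normalizes_OP [Finite G] {p : ℕ} [Fact p.Prime] {A B H : Subgroup G} (hA : SN A H)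
    (hB : SN B H) (hp : IsPGroup p B) {b : G} (hb : b ∈ B) {x : G} (hx : x ∈ OP p A) :
    b * x * b⁻¹ ∈ OP p A := by
  obtain ⟨Q, hQ, hQp, hBQ⟩ := hB.exists_normal hp
  have : OP p A ≤ cj b⁻¹ (OP p A) := by
    unfold OP
    rw [Subgroup.closure_le]
    rintro a ⟨ha, hap⟩
    rw [SetLike.mem_coe, mem_cj]
    apply Subgroup.subset_closure
    have ho : orderOf (b⁻¹⁻¹ * a * b⁻¹) = orderOf a := by
      have := orderOf_injective (MulAut.conj b).toMonoidHom (MulAut.conj b).injective a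
      simpa using this
    have ho' : (orderOf (b⁻¹⁻¹ * a * b⁻¹)).Coprime p := by rw [ho]; exact hap
    refine ⟨?_, ho'⟩
    have hbH := hB.le hb
    have haH := hA.le ha
    refine hA.pprime hQp ho' ?_ ha (q := (a⁻¹ * b * a⁻¹⁻¹) * b⁻¹) ?_ ?_
    · simpa using H.mul_mem (H.mul_mem hbH haH) (H.inv_mem hbH)
    · exact Q.mul_mem (hQ.2 _ (H.inv_mem haH) _ (hBQ hb)) (Q.inv_mem (hBQ hb))
    · group
  simpa [mem_cj] using this hx

/-- nonabelian simple -/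
def NAS (B : Subgroup G) : Prop := ⁅B, B⁆ = B ∧ ∀ C, SN C B → C = ⊥ ∨ C = B

theorem comm_le_left {A B H : Subgroup G} (h : NS A H) (hB : B ≤ H) : ⁅A, B⁆ ≤ A := by
  rw [Subgroup.commutator_le]
  intro a ha b hb
  rw [commutatorElement_def, mul_assoc, mul_assoc, ← mul_assoc b]
  exact A.mul_mem ha (h.2 _ (hB hb) _ (A.inv_mem ha))

theorem NAS.aux [Finite G] (n : ℕ) : ∀ A B H : Subgroup G, Nat.card H ≤ n → SN A H → SN B H → NAS B →
    B ≤ A ∨ ⁅A, B⁆ = ⊥ := by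
  induction n with
  | zero =>
    intro A B H hn
    have : 0 < Nat.card H := Nat.card_pos
    omega
  | succ n ih =>
    intro A B H hn hA hB hN
    have hlt : ∀ K : Subgroup G, K < H → Nat.card K ≤ n := by
      intro K hK
      have := Set.ncard_lt_ncard (s := (K : Set G)) (t := H) hK
      have h1 : Nat.card K < Nat.card H := this
      omega
    rcases hA.top with rfl | ⟨H1, hA1, hH1, hl1⟩
    · exact Or.inl hB.le
    rcases hB.top with rfl | ⟨H2, hB2, hH2, hl2⟩
    · rcases hN.2 A hA with rfl | rfl
      · right; simp
      · left; exact le_rfl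
    have hs : SN (H1 ⊓ B) B := by
      have := hH1.sn.inf B
      rwa [inf_eq_right.2 hB.le] at this
    rcases hN.2 _ hs with h | h
    · right
      have hM : NS (H1 ⊓ H2) H2 := by
        have := hH1.inf H2
        rwa [inf_eq_right.2 hl2.le] at this
      have h1 : ⁅H1 ⊓ H2, B⁆ = ⊥ := by
        rcases ih _ _ H2 (hlt _ hl2) hM.sn hB2 hN with h' | h'
        · have : B = ⊥ := by
            rw [← h, right_eq_inf]; exact h'.trans inf_le_left
          simp [this]
        · exact h'
      have h2 : ⁅H1, B⁆ ≤ H1 ⊓ H2 := by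
        refine le_inf (comm_le_left hH1 hB.le) ?_
        calc ⁅H1, B⁆ ≤ ⁅H1, H2⁆ := Subgroup.commutator_mono le_rfl hB2.le
          _ = ⁅H2, H1⁆ := Subgroup.commutator_comm _ _
          _ ≤ H2 := comm_le_left hH2 hH1.1
      have h3 : ⁅⁅H1, B⁆, B⁆ = ⊥ := by
        rw [eq_bot_iff, ← h1]; exact Subgroup.commutator_mono h2 le_rfl
      have h4 : ⁅⁅B, B⁆, H1⁆ = ⊥ := by
        apply Subgroup.commutator_commutator_eq_bot_of_rotate
        · rw [Subgroup.commutator_comm B H1]; exact h3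
        · exact h3
      rw [hN.1, Subgroup.commutator_comm] at h4
      rw [eq_bot_iff, ← h4]
      exact Subgroup.commutator_mono hA1.le le_rfl
    · have hBH1 : B ≤ H1 := by rw [← h]; exact inf_le_left
      exact ih A B H1 (hlt _ hl1) hA1 (hB.of_le hBH1 hl1.le) hN

theorem NAS.normalizes [Finite G] {A B H : Subgroup G} (hA : SN A H) (hB : SN B H) (hN : NAS B)
    {b : G} (hb : b ∈ B) {x : G} (hx : x ∈ A) : b * x * b⁻¹ ∈ A := by
  rcases NAS.aux _ A B H le_rfl hA hB hN with h | h
  · exact A.mul_mem (A.mul_mem (h hb) hx) (A.inv_mem (h hb))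
  · have : ⁅x, b⁆ = 1 := by
      have := Subgroup.commutator_mem_commutator hx hb
      rw [h] at this
      simpa using this
    rw [commutatorElement_eq_one_iff_mul_comm] at this
    rw [← this]; simpa using hx

theorem NAS.conj {B : Subgroup G} (h : NAS B) (g : G) : NAS (cj g B) := by
  constructor
  · unfold cj
    rw [← Subgroup.map_commutator, h.1]
  · intro C hC
    have := hC.conj g⁻¹
    rw [cj_cj, inv_mul_cancel, cj_one] at this
    have e : C = cj g (cj g⁻¹ C) := by rw [cj_cj, mul_inv_cancel, cj_one]
    rcases h.2 _ this with h | h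
    · left; rw [e, h, cj_bot]
    · right; rw [e, h]

/-- a nontrivial finite group has a simple subnormal subgroup -/
theorem exists_simple [Finite G] {K : Subgroup G} (hK : K ≠ ⊥) :
    ∃ B, SN B K ∧ B ≠ ⊥ ∧ (NAS B ∨ ∃ p : ℕ, p.Prime ∧ IsPGroup p B) := by
  obtain ⟨B, hle, hB⟩ := Set.Finite.exists_le_minimal
      (Set.toFinite {B : Subgroup G | SN B K ∧ B ≠ ⊥}) (a := K) ⟨SN.refl K, hK⟩
  have hs : ∀ C, SN C B → C = ⊥ ∨ C = B := by
    intro C hC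
    by_cases h : C = ⊥
    · exact Or.inl h
    · exact Or.inr (le_antisymm hC.le (hB.2 ⟨hC.trans hB.1.1, h⟩ hC.le))
  refine ⟨B, hB.1.1, hB.1.2, ?_⟩
  have hBB : NS B B := ⟨le_rfl, fun b hb a ha => B.mul_mem (B.mul_mem hb ha) (B.inv_mem hb)⟩
  have hc : NS ⁅B, B⁆ B := by
    have hle : ⁅B, B⁆ ≤ B := comm_le_left hBB le_rfl
    refine ⟨hle, fun b hb a ha => ?_⟩
    have : b * a * b⁻¹ = ⁅b, a⁆ * a := by rw [commutatorElement_def]; group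
    rw [this]
    exact Subgroup.mul_mem _ (Subgroup.commutator_mem_commutator hb (hle ha)) ha
  rcases hs _ hc.sn with h | h
  · right
    obtain ⟨x, hx, hx1⟩ := (Subgroup.bot_or_exists_ne_one B).resolve_left hB.1.2
    have hcomm : ∀ a ∈ B, ∀ b ∈ B, b * a * b⁻¹ = a := by
      intro a ha b hb
      have := Subgroup.commutator_mem_commutator hb ha
      rw [h, Subgroup.mem_bot, commutatorElement_eq_one_iff_mul_comm] at this
      rw [this]; simp
    have hsub : ∀ C : Subgroup G, C ≤ B → C = ⊥ ∨ C = B := by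
      intro C hC
      refine hs C (NS.sn ⟨hC, fun b hb a ha => ?_⟩)
      rw [hcomm a (hC ha) b hb]; exact ha
    obtain ⟨p, hp, hpd⟩ := Nat.exists_prime_and_dvd (n := orderOf x) (by simpa using hx1)
    refine ⟨p, hp, ?_⟩
    have hy : orderOf (x ^ (orderOf x / p)) = p := by
      exact orderOf_pow_orderOf_div (orderOf_pos x).ne' hpd
    rcases hsub (Subgroup.zpowers (x ^ (orderOf x / p)))
      (Subgroup.zpowers_le.2 (B.pow_mem hx _)) with e | e
    · rw [Subgroup.zpowers_eq_bot] at e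
      rw [e, orderOf_one] at hy
      exact absurd hy.symm hp.ne_one
    · apply IsPGroup.of_card (n := 1)
      rw [← e, Nat.card_zpowers, hy, pow_one]
  · exact Or.inl ⟨h, hs⟩

end TW

namespace TW
open EdgePrimitivePaper

section graph
variable {V : Type*} {Γ : SimpleGraph V} {G : Type*} [Group G] {φ : G →* (Γ ≃g Γ)}

theorem act_mul (g h : G) (x : V) : φ (g * h) x = φ g (φ h x) := by
  rw [map_mul, RelIso.mul_apply]

theorem act_one (x : V) : φ 1 x = x := by simp

theorem act_inv (g : G) (x : V) : φ g⁻¹ (φ g x) = x := by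
  rw [← act_mul, inv_mul_cancel, act_one]

theorem act_inv' (g : G) (x : V) : φ g (φ g⁻¹ x) = x := by
  rw [← act_mul, mul_inv_cancel, act_one]

theorem act_adj (g : G) {x y : V} : Γ.Adj (φ g x) (φ g y) ↔ Γ.Adj x y := (φ g).map_rel_iff

theorem act_eq_iff (g : G) {x y : V} : φ g⁻¹ x = y ↔ x = φ g y := by
  constructor
  · rintro rfl; rw [act_inv']
  · rintro rfl; rw [act_inv]

theorem mem_vStab {g : G} {x : V} : g ∈ vStab Γ φ x ↔ φ g x = x := Iff.rfl

theorem mem_lk {g : G} {x : V} :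
    g ∈ localKernel Γ φ x ↔ φ g x = x ∧ ∀ y, Γ.Adj x y → φ g y = y := by
  constructor
  · rintro ⟨⟨g, hg⟩, hk, rfl⟩
    refine ⟨hg, fun y hy => ?_⟩
    have := Equiv.congr_fun (MonoidHom.mem_ker.1 hk) ⟨y, hy⟩
    exact congrArg Subtype.val this
  · rintro ⟨h1, h2⟩
    refine ⟨⟨g, h1⟩, ?_, rfl⟩
    rw [SetLike.mem_coe, MonoidHom.mem_ker]
    ext y
    exact h2 y y.2

theorem cj_vStab (g : G) (x : V) : cj g (vStab Γ φ x) = vStab Γ φ (φ g x) := by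
  ext h
  rw [mem_cj, mem_vStab, mem_vStab, act_mul, act_mul, act_eq_iff]

theorem cj_lk (g : G) (x : V) : cj g (localKernel Γ φ x) = localKernel Γ φ (φ g x) := by
  ext h
  rw [mem_cj, mem_lk, mem_lk, act_mul, act_mul, act_eq_iff]
  refine and_congr_right fun _ => ?_
  constructor
  · intro H y hy
    have := H (φ g⁻¹ y) (by rw [← act_adj (φ := φ) g, act_inv']; exact hy)
    rwa [act_mul, act_mul, act_eq_iff, act_inv'] at this
  · intro H y hy
    rw [act_mul, act_mul, act_eq_iff]
    exact H _ ((act_adj g).2 hy)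

theorem lk_le (x : V) : localKernel Γ φ x ≤ vStab Γ φ x := fun _ h => (mem_lk.1 h).1

theorem lk_le' {x y : V} (h : Γ.Adj x y) : localKernel Γ φ x ≤ vStab Γ φ y :=
  fun _ hg => (mem_lk.1 hg).2 y h

theorem lk_ns (x : V) : NS (localKernel Γ φ x) (vStab Γ φ x) := by
  refine ⟨lk_le x, fun b hb a ha => ?_⟩
  have := cj_lk (φ := φ) b x
  rw [mem_vStab.1 hb] at this
  rw [← this]; exact conj_mem_cj.2 ha

theorem lk_ns' {x y : V} (h : Γ.Adj x y) : NS (localKernel Γ φ x) (vStab Γ φ x ⊓ vStab Γ φ y) := 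
  ⟨le_inf (lk_le x) (lk_le' h), fun b hb a ha => (lk_ns x).2 b hb.1 a ha⟩

theorem ns_inf {A B H : Subgroup G} (hA : NS A H) (hB : B ≤ H) : NS (A ⊓ B) B := by
  have := hA.inf B
  rwa [inf_eq_right.2 hB] at this

theorem maximal (hlp : IsLocallyPrimitive Γ φ) {x y : V} (h : Γ.Adj x y) {M : Subgroup G}
    (hM : vStab Γ φ x ⊓ vStab Γ φ y ≤ M) {g : G} (hgM : g ∈ M) (hg : g ∈ vStab Γ φ x)
    (hgy : g ∉ vStab Γ φ y) : vStab Γ φ x ≤ M := by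
  have hc := (hlp x).2 ⟨y, h⟩
  let M' : Subgroup (localGroup Γ φ x) :=
    (M.subgroupOf (vStab Γ φ x)).map (localHom Γ φ x).rangeRestrict
  have hle : MulAction.stabilizer (localGroup Γ φ x) (⟨y, h⟩ : Γ.neighborSet x) ≤ M' := by
    rintro ⟨_, ⟨s, rfl⟩⟩ hs
    refine ⟨s, ?_, rfl⟩
    have hs' : localHom Γ φ x s ⟨y, h⟩ = ⟨y, h⟩ := hs
    have : φ (s : G) y = y := congrArg Subtype.val hs'
    exact hM ⟨s.2, this⟩
  have hne : MulAction.stabilizer (localGroup Γ φ x) (⟨y, h⟩ : Γ.neighborSet x) ≠ M' := by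
    intro e
    have : (localHom Γ φ x).rangeRestrict ⟨g, hg⟩ ∈ M' := ⟨⟨g, hg⟩, hgM, rfl⟩
    rw [← e] at this
    have hs' : localHom Γ φ x ⟨g, hg⟩ ⟨y, h⟩ = ⟨y, h⟩ := this
    exact hgy (congrArg Subtype.val hs')
  have htop := hc.2 M' (lt_of_le_of_ne hle hne)
  intro s hs
  have : (localHom Γ φ x).rangeRestrict ⟨s, hs⟩ ∈ M' := by rw [htop]; trivial
  obtain ⟨m, hm, e⟩ := this
  have hm' : (m : G) ∈ M := hm
  have e' : localHom Γ φ x m = localHom Γ φ x ⟨s, hs⟩ := congrArg Subtype.val e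
  have hk : (m : G)⁻¹ * s ∈ localKernel Γ φ x := by
    refine ⟨m⁻¹ * ⟨s, hs⟩, ?_, rfl⟩
    rw [SetLike.mem_coe, MonoidHom.mem_ker, map_mul, map_inv, e', inv_mul_cancel]
  have h2 : (m : G)⁻¹ * s ∈ M := hM ⟨lk_le x hk, lk_le' h hk⟩
  simpa using M.mul_mem hm' h2

theorem arc_trans (hvt : IsVertexTransitive Γ φ) (hlp : IsLocallyPrimitive Γ φ) {x y a b : V}
    (h : Γ.Adj x y) (h' : Γ.Adj a b) : ∃ g : G, φ g x = a ∧ φ g y = b := by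
  obtain ⟨g, hg⟩ := hvt x a
  have h1 : Γ.Adj a (φ g y) := by rw [← hg]; exact (act_adj g).2 h
  obtain ⟨_, ⟨s, rfl⟩, hs⟩ := (hlp a).1 ⟨φ g y, h1⟩ ⟨b, h'⟩
  refine ⟨s * g, ?_, ?_⟩
  · rw [act_mul, hg]; exact s.2
  · rw [act_mul]; exact congrArg Subtype.val hs

theorem trivial_of_normal (hφ : Function.Injective φ) (hconn : Γ.Connected)
    (hlp : IsLocallyPrimitive Γ φ) {x y : V} (h : Γ.Adj x y) {N : Subgroup G}
    (hN : N ≤ vStab Γ φ x ⊓ vStab Γ φ y) (h1 : vStab Γ φ x ≤ Subgroup.normalizer N)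
    (h2 : vStab Γ φ y ≤ Subgroup.normalizer N) : N = ⊥ := by
  have key : ∀ z, ∃ l ∈ Subgroup.normalizer (N : Set G), z = φ l x ∨ z = φ l y := by
    intro z
    obtain ⟨w⟩ := hconn.preconnected z x
    induction w with
    | nil => exact ⟨1, Subgroup.one_mem _, Or.inl (act_one _).symm⟩
    | @cons a b c hab _ ih =>
      obtain ⟨l, hl, rfl | rfl⟩ := ih h hN h1
      · have hadj : Γ.Adj c (φ l⁻¹ a) := by rw [← act_adj (φ := φ) l, act_inv']; exact hab.symm
        obtain ⟨_, ⟨s, rfl⟩, hs⟩ := (hlp c).1 ⟨y, h⟩ ⟨_, hadj⟩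
        have hs' : φ (s : G) y = φ l⁻¹ a := congrArg Subtype.val hs
        exact ⟨l * s, Subgroup.mul_mem _ hl (h1 s.2), Or.inr (by rw [act_mul, hs', act_inv'])⟩
      · have hadj : Γ.Adj y (φ l⁻¹ a) := by rw [← act_adj (φ := φ) l, act_inv']; exact hab.symm
        obtain ⟨_, ⟨s, rfl⟩, hs⟩ := (hlp y).1 ⟨c, h.symm⟩ ⟨_, hadj⟩
        have hs' : φ (s : G) c = φ l⁻¹ a := congrArg Subtype.val hs
        exact ⟨l * s, Subgroup.mul_mem _ hl (h2 s.2), Or.inl (by rw [act_mul, hs', act_inv'])⟩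
  rw [eq_bot_iff]
  intro n hn
  rw [Subgroup.mem_bot]
  apply hφ
  rw [map_one]
  ext z
  change φ n z = z
  obtain ⟨l, hl, hz⟩ := key z
  have hn' : l⁻¹ * n * l ∈ N := (Subgroup.mem_normalizer_iff''.1 hl n).1 hn
  have hn2 := hN hn'
  rcases hz with rfl | rfl
  · have := mem_vStab.1 hn2.1
    rwa [act_mul, act_mul, act_eq_iff] at this
  · have := mem_vStab.1 hn2.2
    rwa [act_mul, act_mul, act_eq_iff] at this

theorem mem_norm_of_cj {N : Subgroup G} {S : Subgroup G} (h : ∀ g ∈ S, cj g N ≤ N) :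
    S ≤ Subgroup.normalizer N := by
  intro g hg
  rw [Subgroup.mem_normalizer_iff]
  intro x
  refine ⟨fun hx => h g hg (conj_mem_cj.2 hx), fun hx => ?_⟩
  have := h _ (S.inv_mem hg) (conj_mem_cj.2 hx)
  convert this using 1; group

/-- The abstract core of the Thompson-Wielandt argument. -/
theorem core [Finite G] (hφ : Function.Injective φ) (hconn : Γ.Connected)
    (hvt : IsVertexTransitive Γ φ) (hlp : IsLocallyPrimitive Γ φ)
    (F : Subgroup G → Subgroup G) (P : Subgroup G → Prop)
    (hF : ∀ g A, cj g (F A) ≤ F (cj g A)) (hFle : ∀ A, F A ≤ A)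
    (hP : ∀ g B, P B → P (cj g B))
    (hFP : ∀ A B H : Subgroup G, SN A H → SN B H → P B → ∀ b ∈ B, ∀ x ∈ F A, b * x * b⁻¹ ∈ F A)
    (hne : ∀ x y, Γ.Adj x y → F (localKernel Γ φ x ⊓ localKernel Γ φ y) ≠ ⊥)
    {x y : V} (h : Γ.Adj x y) {B : Subgroup G} (hB : SN B (localKernel Γ φ x)) (hPB : P B) :
    B = ⊥ := by
  -- the normalizer of `F X` in a vertex stabilizer
  have c1 : ∀ x y, Γ.Adj x y → ∀ g ∈ vStab Γ φ x,
      g ∈ Subgroup.normalizer (F (localKernel Γ φ x ⊓ localKernel Γ φ y) : Set G) →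
      g ∈ vStab Γ φ y := by
    intro x y h g hg hgn
    by_contra hgy
    set X := localKernel Γ φ x ⊓ localKernel Γ φ y with hX
    have h0 : vStab Γ φ x ⊓ vStab Γ φ y ≤ Subgroup.normalizer (F X : Set G) := by
      refine mem_norm_of_cj fun g hg => (hF g X).trans (le_of_eq ?_)
      rw [hX, cj_inf, cj_lk, cj_lk, mem_vStab.1 hg.1, mem_vStab.1 hg.2]
    have h1 := maximal hlp h h0 hgn hg hgy
    obtain ⟨t, ht1, ht2⟩ := arc_trans hvt hlp h h.symm
    have ht : cj t X = X := by
      rw [hX, cj_inf, cj_lk, cj_lk, ht1, ht2, inf_comm]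
    have htF : t ∈ Subgroup.normalizer (F X : Set G) := by
      have : ∀ s : G, cj s X = X → cj s (F X) ≤ F X := fun s hs => (hF s X).trans (by rw [hs])
      have ht' : cj t⁻¹ X = X := by
        conv_lhs => rw [← ht]
        rw [cj_cj, inv_mul_cancel, cj_one]
      rw [Subgroup.mem_normalizer_iff]
      intro z
      refine ⟨fun hz => this t ht (conj_mem_cj.2 hz), fun hz => ?_⟩
      have := this _ ht' (conj_mem_cj.2 hz)
      convert this using 1; group
    have h2 : vStab Γ φ y ≤ Subgroup.normalizer (F X : Set G) := by
      intro s hs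
      rw [← ht1, ← cj_vStab, mem_cj] at hs
      have := Subgroup.mul_mem _ (Subgroup.mul_mem _ htF (h1 hs)) (Subgroup.inv_mem _ htF)
      convert this using 1; group
    refine hne x y h (trivial_of_normal hφ hconn hlp h ?_ h1 h2)
    exact (hFle X).trans (inf_le_inf (lk_le x) (lk_le y))
  have c2 : ∀ x y, Γ.Adj x y → ∀ B, SN B (localKernel Γ φ x) → P B → B ≤ localKernel Γ φ y := by
    intro x y h B hB hPB b hb
    rw [mem_lk]
    have hby : b ∈ vStab Γ φ y := lk_le' h (hB.le hb)
    refine ⟨hby, fun w hw => ?_⟩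
    have hBH : SN B (vStab Γ φ x ⊓ vStab Γ φ y) := hB.trans (lk_ns' h).sn
    have hAH : SN (localKernel Γ φ w ⊓ localKernel Γ φ y) (vStab Γ φ x ⊓ vStab Γ φ y) := by
      refine (ns_inf (lk_ns' hw.symm) (le_inf (lk_le' hw) (lk_le y))).sn.trans ?_
      rw [inf_comm]; exact (lk_ns' h.symm).sn
    rw [inf_comm] at hAH
    refine c1 y w hw b hby ?_
    refine mem_norm_of_cj (S := B) ?_ hb
    intro g hg z hz
    rw [mem_cj] at hz
    have := hFP _ B _ hAH hBH hPB g hg _ hz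
    convert this using 1; group
  have c3 : ∀ x y, Γ.Adj x y → ∀ B, SN B (localKernel Γ φ x) → P B → SN B (localKernel Γ φ y) := by
    intro x y h B hB hPB
    have hle := c2 x y h B hB hPB
    have h1 : SN B (localKernel Γ φ x ⊓ localKernel Γ φ y) :=
      hB.of_le (le_inf hB.le hle) inf_le_left
    exact h1.trans (ns_inf (lk_ns' h) (le_inf (lk_le' h.symm) (lk_le y))).sn
  let D := sSup {B : Subgroup G | SN B (localKernel Γ φ x) ∧ P B}
  have hD : ∀ z, (z = x ∨ z = y) → vStab Γ φ z ≤ Subgroup.normalizer (D : Set G) := by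
    intro z hz
    have e : D = sSup {B : Subgroup G | SN B (localKernel Γ φ z) ∧ P B} := by
      rcases hz with rfl | rfl
      · rfl
      · change sSup _ = sSup _
        congr 1
        ext C
        exact ⟨fun hC => ⟨c3 _ _ h C hC.1 hC.2, hC.2⟩, fun hC => ⟨c3 _ _ h.symm C hC.1 hC.2, hC.2⟩⟩
    rw [e]
    refine mem_norm_of_cj fun g hg => ?_
    unfold cj
    rw [Subgroup.map_le_iff_le_comap]
    refine sSup_le fun C hC => ?_
    rw [← Subgroup.map_le_iff_le_comap]
    refine le_sSup ⟨?_, hP g C hC.2⟩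
    have := hC.1.conj g
    rwa [cj_lk, mem_vStab.1 hg] at this
  have hbot : D = ⊥ := by
    refine trivial_of_normal hφ hconn hlp h ?_ (hD x (Or.inl rfl)) (hD y (Or.inr rfl))
    refine sSup_le fun C hC => hC.1.le.trans (le_inf (lk_le x) (lk_le' h))
  rw [eq_bot_iff, ← hbot]
  exact le_sSup ⟨hB, hPB⟩

theorem part_one [Finite G] (hφ : Function.Injective φ) (hconn : Γ.Connected)
    (hvt : IsVertexTransitive Γ φ) (hlp : IsLocallyPrimitive Γ φ) {u v : V} (h : Γ.Adj u v) :
    ∃ p : ℕ, p.Prime ∧ IsPGroup p ↥(localKernel Γ φ u ⊓ localKernel Γ φ v) := by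
  by_contra! hcon
  have hall : ∀ x y, Γ.Adj x y → ∀ p : ℕ, p.Prime →
      ¬ IsPGroup p ↥(localKernel Γ φ x ⊓ localKernel Γ φ y) := by
    intro x y hxy p hp hX
    obtain ⟨g, h1, h2⟩ := arc_trans hvt hlp hxy h
    have := isPGroup_cj hX g
    rw [cj_inf, cj_lk, cj_lk, h1, h2] at this
    exact hcon p hp this
  have hnb : ∀ x y, Γ.Adj x y → localKernel Γ φ x ⊓ localKernel Γ φ y ≠ ⊥ := by
    intro x y hxy e
    apply hall x y hxy 2 Nat.prime_two
    rw [e]; exact IsPGroup.of_bot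
  have hK : localKernel Γ φ u ≠ ⊥ := fun e => hnb u v h (by rw [e, bot_inf_eq])
  obtain ⟨B, hB, hB0, hN | ⟨p, hp, hBp⟩⟩ := exists_simple hK
  · exact hB0 (core hφ hconn hvt hlp id NAS (fun _ _ => le_rfl) (fun _ => le_rfl)
      (fun g B hB => hB.conj g)
      (fun A B H hA hB hN b hb x hx => NAS.normalizes hA hB hN hb hx) hnb h hB hN)
  · haveI := Fact.mk hp
    exact hB0 (core hφ hconn hvt hlp (OP p) (fun B => IsPGroup p B) (cj_OP_le p) (OP_le p)
      (fun g B hB => isPGroup_cj hB g)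
      (fun A B H hA hB hN b hb x hx => SN.normalizes_OP hA hB hN hb hx)
      (fun x y hxy => OP_ne_bot hp (hall x y hxy p hp)) h hB hBp)

theorem mem_induced {H : Subgroup G} {x : V} {σ : Equiv.Perm (Γ.neighborSet x)} :
    σ ∈ inducedLocal Γ φ H x ↔ ∃ g ∈ H, φ g x = x ∧ ∀ y : Γ.neighborSet x, (σ y : V) = φ g y := by
  constructor
  · rintro ⟨s, hs, rfl⟩
    exact ⟨s, hs, s.2, fun y => rfl⟩
  · rintro ⟨g, hg, hgx, e⟩
    exact ⟨⟨g, hgx⟩, hg, by ext y; exact (e y).symm⟩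

theorem part_two (hvt : IsVertexTransitive Γ φ) (hlp : IsLocallyPrimitive Γ φ)
    {u v : V} (h : Γ.Adj v u) :
    ∃ M : Subgroup ↥(MulAction.stabilizer ↥(localGroup Γ φ v) (⟨u, h⟩ : Γ.neighborSet v)),
      M.Normal ∧ Nonempty (↥(inducedLocal Γ φ (localKernel Γ φ v) u) ≃* ↥M) := by
  obtain ⟨t, ht1, ht2⟩ := arc_trans hvt hlp h.symm h
  let e : Γ.neighborSet u ≃ Γ.neighborSet v :=
    { toFun := fun y => ⟨φ t y, by
        have := (act_adj (φ := φ) t).2 y.2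
        rwa [ht1] at this⟩
      invFun := fun y => ⟨φ t⁻¹ y, by
        have := (act_adj (φ := φ) t⁻¹).2 y.2
        rwa [(act_eq_iff t).2 ht1.symm] at this⟩
      left_inv := fun y => Subtype.ext (act_inv t _)
      right_inv := fun y => Subtype.ext (act_inv' t _) }
  set N := inducedLocal Γ φ (localKernel Γ φ u) v with hN
  have hmap : (inducedLocal Γ φ (localKernel Γ φ v) u).map (e.permCongrHom : _ →* _) = N := by
    ext σ
    constructor
    · rintro ⟨τ, hτ, rfl⟩
      obtain ⟨g, hg, hgu, hgy⟩ := mem_induced.1 hτ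
      refine mem_induced.2 ⟨t * g * t⁻¹, ?_, ?_, ?_⟩
      · rw [← ht2, ← cj_lk]; exact conj_mem_cj.2 hg
      · rw [act_mul, act_mul, (act_eq_iff t).2 ht1.symm, hgu, ht1]
      · intro y
        rw [act_mul, act_mul]
        exact congrArg (φ t) (hgy (e.symm y))
    · intro hσ
      obtain ⟨g, hg, hgv, hgy⟩ := mem_induced.1 hσ
      refine ⟨e.permCongrHom.symm σ, mem_induced.2 ⟨t⁻¹ * g * t, ?_, ?_, ?_⟩, ?_⟩
      · rw [← ht2, ← cj_lk, mem_cj] at hg; exact hg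
      · rw [act_mul, act_mul, ht1, hgv, act_eq_iff, ht1]
      · intro y
        rw [act_mul, act_mul]
        exact congrArg (φ t⁻¹) (hgy (e y))
      · exact e.permCongrHom.apply_symm_apply σ
  have hNl : N ≤ localGroup Γ φ v := by
    rintro _ ⟨s, _, rfl⟩; exact ⟨s, rfl⟩
  have hNs : N.subgroupOf (localGroup Γ φ v) ≤
      MulAction.stabilizer ↥(localGroup Γ φ v) (⟨u, h⟩ : Γ.neighborSet v) := by
    intro σ hσ
    obtain ⟨g, hg, hgv, hgy⟩ := mem_induced.1 (Subgroup.mem_subgroupOf.1 hσ)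
    rw [MulAction.mem_stabilizer_iff]
    apply Subtype.ext
    exact (hgy ⟨u, h⟩).trans (lk_le u hg)
  refine ⟨(N.subgroupOf (localGroup Γ φ v)).subgroupOf _, ⟨?_⟩, ⟨?_⟩⟩
  · rintro ⟨⟨_, ⟨n, rfl⟩⟩, h1⟩ hn ⟨⟨_, ⟨s, rfl⟩⟩, hs⟩
    have hn' : localHom Γ φ v n ∈ N := hn
    have hsu : φ (s : G) u = u := congrArg Subtype.val (MulAction.mem_stabilizer_iff.1 hs)
    change localHom Γ φ v s * localHom Γ φ v n * (localHom Γ φ v s)⁻¹ ∈ N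
    obtain ⟨k, hk, e⟩ := hn'
    rw [← e, ← map_inv, ← map_mul, ← map_mul]
    refine ⟨_, ?_, rfl⟩
    exact (lk_ns u).2 (s : G) hsu k hk
  · exact (e.permCongrHom.subgroupMap _).trans ((MulEquiv.subgroupCongr hmap).trans
      ((Subgroup.subgroupOfEquivOfLe hNl).symm.trans (Subgroup.subgroupOfEquivOfLe hNs).symm))

theorem part_three [Finite G] {p : ℕ} (hp : p.Prime) {u v : V} (h : Γ.Adj v u)
    (hX : IsPGroup p ↥(localKernel Γ φ u ⊓ localKernel Γ φ v))
    (hI : Group.IsSolvable (localGroup Γ φ v) → Group.IsSolvable (inducedLocal Γ φ (localKernel Γ φ v) u)) :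
    Group.IsSolvable ↥(vStab Γ φ v) ↔ Group.IsSolvable ↥(localGroup Γ φ v) := by
  haveI := Fact.mk hp
  constructor
  · intro hs
    exact Group.isSolvable_of_surjective (localHom Γ φ v).rangeRestrict_surjective
  · intro hs
    haveI := hI hs
    let K' := (localKernel Γ φ v).subgroupOf (vStab Γ φ u)
    haveI hK' : Group.IsSolvable K' := by
      let ψ := (localHom Γ φ u).subgroupMap K'
      haveI : Group.IsSolvable (K'.map (localHom Γ φ u)) := hI hs
      have hker : IsPGroup p ψ.ker := by
        rw [isPGroup_iff]
        intro k hk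
        have hk' : ((k : vStab Γ φ u) : G) ∈ localKernel Γ φ u ⊓ localKernel Γ φ v := by
          refine ⟨⟨(k : vStab Γ φ u), ?_, rfl⟩, k.2⟩
          exact congrArg Subtype.val (MonoidHom.mem_ker.1 hk)
        obtain ⟨n, hn⟩ := isPGroup_iff.1 hX _ hk'
        exact ⟨n, Subtype.ext (Subtype.ext hn)⟩
      haveI := hker.isNilpotent
      exact Group.isSolvable_of_ker_le_range ψ.ker.subtype ψ (by simp)
    haveI : Group.IsSolvable (localKernel Γ φ v) :=
      let e : K' ≃* localKernel Γ φ v := Subgroup.subgroupOfEquivOfLe (lk_le' h)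
      Group.isSolvable_of_surjective (f := e.toMonoidHom) e.surjective
    haveI : Group.IsSolvable (localHom Γ φ v).ker :=
      let e := (localHom Γ φ v).ker.equivMapOfInjective (vStab Γ φ v).subtype
        (Subgroup.subtype_injective _)
      haveI : Group.IsSolvable ((localHom Γ φ v).ker.map (vStab Γ φ v).subtype) := this
      Group.isSolvable_of_surjective (f := e.symm.toMonoidHom) e.symm.surjective
    haveI : Group.IsSolvable (localHom Γ φ v).range := hs
    exact Group.isSolvable_of_ker_le_range (localHom Γ φ v).ker.subtype (localHom Γ φ v).rangeRestrict
      (by simp)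

end graph
end TW


open EdgePrimitivePaper in
/-- **Lemma 2.5.** For a vertex-transitive, locally primitive group
`G ≤ Aut Γ` and an edge `{u,v}`: (i) `G_{uv}^{[1]}` is a `p`-group for some prime `p`;
(ii) the group induced by `G_v^{[1]}` on `Γ(u)` is isomorphic to a normal subgroup of the
point stabilizer `(G_v^{Γ(v)})_u`; (iii) `G_v` is soluble iff `G_v^{Γ(v)}` is soluble. -/
theorem stmt_15 {V : Type*} [Fintype V] (Γ : SimpleGraph V) [DecidableRel Γ.Adj]
    (d : ℕ) (hd : 3 ≤ d) (hconn : Γ.Connected) (hreg : Γ.IsRegularOfDegree d)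
    (A : Subgroup (Γ ≃g Γ))
    (hvt : IsVertexTransitive Γ A.subtype)
    (hlp : IsLocallyPrimitive Γ A.subtype)
    {u v : V} (huv : s(u, v) ∈ Γ.edgeSet) :
    (∃ p : ℕ, p.Prime ∧
        IsPGroup p ↥(localKernel Γ A.subtype u ⊓ localKernel Γ A.subtype v)) ∧
    (∃ M : Subgroup ↥(MulAction.stabilizer ↥(localGroup Γ A.subtype v)
        (⟨u, (Γ.mem_edgeSet.mp huv).symm⟩ : Γ.neighborSet v)),
      M.Normal ∧
        Nonempty (↥(inducedLocal Γ A.subtype (localKernel Γ A.subtype v) u) ≃* ↥M)) ∧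
    (IsSolvable ↥(vStab Γ A.subtype v) ↔ IsSolvable ↥(localGroup Γ A.subtype v)) := by
  have hadj : Γ.Adj v u := (Γ.mem_edgeSet.mp huv).symm
  haveI : Finite (Γ ≃g Γ) := Finite.of_injective (fun f => (f : V → V)) DFunLike.coe_injective
  obtain ⟨p, hp, hX⟩ := TW.part_one A.subtype_injective hconn hvt hlp hadj.symm
  obtain ⟨M, hM, ⟨e⟩⟩ := TW.part_two hvt hlp hadj
  refine ⟨⟨p, hp, hX⟩, ⟨M, hM, ⟨e⟩⟩, TW.part_three hp hadj hX fun hs => ?_⟩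
  exact Group.isSolvable_of_surjective (f := e.symm.toMonoidHom) e.symm.surjective
end
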